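/- arXiv:1409.2809 — 2 statements merged into one kernel-verified Lean document; each statement's English description precedes it below -/
import Mathlib

section
/- Let F be a free group (on an arbitrary set of generators) and let x ∈ F be a nontrivial element. Then the centralizer C_F(x) = {g ∈ F : gx = xg} is an infinite cyclic subgroup of F. -/
namespace FreeGroup

/-- If `z` commutes with the generator `a`, then the reduced word of `z`, when nonempty, starts
with `a` or its inverse. -/
theorem eq_of_commute_of_toWord_eq_cons {α : Type*} [DecidableEq α] {z : FreeGroup α} {a : α}
    (h : Commute (of a) z) {p : α × Bool} {L : List (α × Bool)} (hz : z.toWord = p :: L) :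
    p.1 = a := by
  by_contra hne
  have hred : IsReduced (p :: L) := hz ▸ isReduced_toWord
  have hleft : (of a * z).toWord = (a, true) :: p :: L := by
    rw [toWord_mul, toWord_of, hz, List.singleton_append]
    exact (isReduced_cons_cons.mpr ⟨fun hap => absurd hap.symm hne, hred⟩).reduce_eq
  have hright : (of a * z).toWord = p :: L ++ [(a, true)] := by
    have hsub := toWord_mul_sublist z (of a)
    rw [← h.eq, hz, toWord_of] at hsub
    exact hsub.eq_of_length (by simp [hleft])
  have heq := hleft.symm.trans hright
  simp only [List.cons_append, List.cons.injEq] at heq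
  exact hne (congrArg Prod.fst heq.1.symm)

theorem subsingleton_of_mem_center {α : Type*} {z : FreeGroup α}
    (hz : z ∈ Subgroup.center (FreeGroup α)) (hne : z ≠ 1) : Subsingleton α := by
  classical
  obtain ⟨p, L, hw⟩ := List.exists_cons_of_ne_nil (mt toWord_eq_nil_iff.mp hne)
  have key (a : α) : p.1 = a :=
    eq_of_commute_of_toWord_eq_cons (Subgroup.mem_center_iff.mp hz (of a)) hw
  exact ⟨fun a b => (key a).symm.trans (key b)⟩

theorem isCyclic_of_mem_center {α : Type*} {z : FreeGroup α}
    (hz : z ∈ Subgroup.center (FreeGroup α)) (hne : z ≠ 1) : IsCyclic (FreeGroup α) := by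
  have := subsingleton_of_mem_center hz hne
  cases isEmpty_or_nonempty α
  · infer_instance
  · have := uniqueOfSubsingleton (Classical.arbitrary α)
    infer_instance

end FreeGroup

theorem IsFreeGroup.isCyclic_of_mem_center {G : Type*} [Group G] [IsFreeGroup G] {z : G}
    (hz : z ∈ Subgroup.center G) (hne : z ≠ 1) : IsCyclic G := by
  let e := IsFreeGroup.toFreeGroup G
  have hcenter : e z ∈ Subgroup.center (FreeGroup (IsFreeGroup.Generators G)) := by
    refine Subgroup.mem_center_iff.mpr fun g => e.symm.injective ?_
    simpa using Subgroup.mem_center_iff.mp hz (e.symm g)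
  have := FreeGroup.isCyclic_of_mem_center hcenter (by simpa using hne)
  exact isCyclic_of_surjective e.symm e.symm.surjective

theorem stmt2 {α : Type*} (x : FreeGroup α) (hx : x ≠ 1) :
    ∃ g : FreeGroup α, ¬ IsOfFinOrder g ∧
      Subgroup.centralizer {x} = Subgroup.zpowers g := by
  have hmem : x ∈ Subgroup.centralizer {x} := Subgroup.mem_centralizer_singleton_iff.mpr rfl
  have hcenter : (⟨x, hmem⟩ : Subgroup.centralizer {x}) ∈
      Subgroup.center (Subgroup.centralizer {x}) :=
    Subgroup.mem_center_iff.mpr fun g =>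
      Subtype.ext (Subgroup.mem_centralizer_singleton_iff.mp g.2)
  have hcyc : IsCyclic (Subgroup.centralizer {x}) :=
    IsFreeGroup.isCyclic_of_mem_center hcenter (by simpa [Subtype.ext_iff] using hx)
  obtain ⟨g, hg⟩ := (Subgroup.isCyclic_iff_exists_zpowers_eq_top _).mp hcyc
  refine ⟨g, ?_, hg.symm⟩
  rw [isOfFinOrder_iff_eq_one]
  rintro rfl
  rw [← hg, Subgroup.zpowers_one_eq_bot, Subgroup.mem_bot] at hmem
  exact hx hmem
end

section
/- Let m ≥ 1 and let H₁, …, H_m be separable Hilbert spaces, each equipped with a Hilbert (orthonormal) basis (e_ℓ^j)_{ℓ ∈ ℕ} of H_j. Let H = H₁ ⊕ ⋯ ⊕ H_m (Hilbert direct sum) and let T : H → H be a bounded linear operator, with block components T_{i,j} = P_i ∘ T ∘ ι_j : H_j → H_i, where ι_j is the inclusion and P_i the orthogonal projection. For k ∈ ℕ define μ_k(T) = inf over closed subspaces V ⊆ H of codimension k of sup{‖Tv‖ : v ∈ V, ‖v‖ = 1} (for T compact this is the k-th singular value of T, i.e. the k-th eigenvalue of √(T*T) in decreasing order). Then, assuming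 each series Σ_{ℓ ≥ 0} ‖T_{i,j} e_ℓ^j‖ converges, for every k ∈ ℕ one has μ_k(T) ≤ #{(i,j) : T_{i,j} ≠ 0} · max_{1 ≤ i,j ≤ m} Σ_{ℓ ≥ ⌊k/m⌋} ‖T_{i,j} e_ℓ^j‖. -/
theorem exists_sum_eq_of_div_le (m : ℕ) (hm : 1 ≤ m) (k : ℕ) :
    ∃ n : Fin m → ℕ, (∀ j, k / m ≤ n j) ∧ ∑ j, n j = k := by
  refine ⟨fun j => k / m + if j = ⟨0, hm⟩ then k % m else 0, fun j => Nat.le_add_right _ _, ?_⟩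
  simp [Finset.sum_add_distrib, Nat.div_add_mod]

theorem HilbertBasis.norm_map_le_tsum_tail {E F : Type*} [NormedAddCommGroup E]
    [InnerProductSpace ℂ E] [NormedAddCommGroup F] [NormedSpace ℂ F]
    (b : HilbertBasis ℕ ℂ E) (B : E →L[ℂ] F) (hB : Summable fun ℓ => ‖B (b ℓ)‖) (q : ℕ)
    (x : E) (hx : ‖x‖ ≤ 1) (hq : ∀ ℓ < q, inner ℂ (b ℓ) x = 0) :
    ‖B x‖ ≤ ∑' ℓ : {ℓ : ℕ // q ≤ ℓ}, ‖B (b ℓ)‖ := by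
  have h1 : HasSum (fun ℓ => B (b.repr x ℓ • b ℓ)) (B x) := (b.hasSum_repr x).mapL B
  have h2 : ∑' ℓ : {ℓ : ℕ // q ≤ ℓ}, ‖B (b ℓ)‖
      = ∑' ℓ, Set.indicator {ℓ : ℕ | q ≤ ℓ} (fun ℓ => ‖B (b ℓ)‖) ℓ :=
    tsum_subtype {ℓ : ℕ | q ≤ ℓ} (fun ℓ => ‖B (b ℓ)‖)
  rw [h2, ← h1.tsum_eq]
  refine tsum_of_norm_bounded (hB.indicator _).hasSum fun ℓ => ?_
  rw [map_smul, norm_smul, b.repr_apply_apply]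
  by_cases hℓ : q ≤ ℓ
  · rw [Set.indicator_of_mem (by exact hℓ)]
    have h3 : ‖inner ℂ (b ℓ) x‖ ≤ 1 := by
      refine (norm_inner_le_norm _ _).trans ?_
      rwa [b.orthonormal.1 ℓ, one_mul]
    exact mul_le_of_le_one_left (norm_nonneg _) h3
  · simp [hq ℓ (not_le.1 hℓ), hℓ]

/-- The coefficients of a vector of the Hilbert sum along the first `n j` basis vectors of each
summand `H j`. -/
noncomputable def leadingCoefficients {m : ℕ} {H : Fin m → Type*}
    [∀ j, NormedAddCommGroup (H j)] [∀ j, InnerProductSpace ℂ (H j)]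
    (e : ∀ j, HilbertBasis ℕ ℂ (H j)) (n : Fin m → ℕ) :
    PiLp 2 H →L[ℂ] ((Σ j, Fin (n j)) → ℂ) :=
  ContinuousLinearMap.pi fun p => (innerSL ℂ (e p.1 p.2)).comp (PiLp.proj 2 H p.1)

theorem leadingCoefficients_apply {m : ℕ} {H : Fin m → Type*}
    [∀ j, NormedAddCommGroup (H j)] [∀ j, InnerProductSpace ℂ (H j)]
    (e : ∀ j, HilbertBasis ℕ ℂ (H j)) (n : Fin m → ℕ) (v : PiLp 2 H) (p : Σ j, Fin (n j)) :
    leadingCoefficients e n v p = inner ℂ (e p.1 p.2) (v p.1) := rfl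

theorem leadingCoefficients_surjective {m : ℕ} {H : Fin m → Type*}
    [∀ j, NormedAddCommGroup (H j)] [∀ j, InnerProductSpace ℂ (H j)]
    (e : ∀ j, HilbertBasis ℕ ℂ (H j)) (n : Fin m → ℕ) :
    Function.Surjective (leadingCoefficients e n) := by
  intro c
  refine ⟨WithLp.toLp 2 fun j => ∑ l : Fin (n j), c ⟨j, l⟩ • e j l, ?_⟩
  ext ⟨j, l⟩
  rw [leadingCoefficients_apply]
  have ho : Orthonormal ℂ fun l : Fin (n j) => e j l :=
    (e j).orthonormal.comp _ Fin.val_injective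
  exact ho.inner_right_fintype (fun l => c ⟨j, l⟩) l

theorem PiLp.norm_le_sum_norm {m : ℕ} {H : Fin m → Type*} [∀ j, NormedAddCommGroup (H j)]
    (v : PiLp 2 H) : ‖v‖ ≤ ∑ j, ‖v j‖ := by
  rw [PiLp.norm_eq_of_L2]
  refine Real.sqrt_le_iff.2 ⟨by positivity, ?_⟩
  exact Finset.sum_sq_le_sq_sum_of_nonneg fun j _ => norm_nonneg _

theorem stmt11 (m : ℕ) (hm : 1 ≤ m) (H : Fin m → Type*)
    [∀ j, NormedAddCommGroup (H j)] [∀ j, InnerProductSpace ℂ (H j)]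
    [∀ j, CompleteSpace (H j)]
    (e : ∀ j, HilbertBasis ℕ ℂ (H j))
    (T : PiLp 2 H →L[ℂ] PiLp 2 H)
    (Tblock : ∀ i j : Fin m, H j → H i)
    (hTblock : ∀ i j : Fin m, ∀ x : H j,
      Tblock i j x =
        WithLp.equiv 2 (∀ k, H k) (T ((WithLp.equiv 2 (∀ k, H k)).symm (Pi.single j x))) i)
    (hsum : ∀ i j : Fin m, Summable fun ℓ : ℕ => ‖Tblock i j (e j ℓ)‖)
    (k : ℕ) :
    sInf {s : ℝ | ∃ V : Submodule ℂ (PiLp 2 H), IsClosed (V : Set (PiLp 2 H)) ∧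
        (∃ _ : FiniteDimensional ℂ (PiLp 2 H ⧸ V), Module.finrank ℂ (PiLp 2 H ⧸ V) = k) ∧
        s = sSup {t : ℝ | ∃ v ∈ V, ‖v‖ = 1 ∧ t = ‖T v‖}} ≤
      (Set.ncard {ij : Fin m × Fin m | ∃ x, Tblock ij.1 ij.2 x ≠ 0} : ℝ) *
        ⨆ ij : Fin m × Fin m, ∑' ℓ : {ℓ : ℕ // k / m ≤ ℓ}, ‖Tblock ij.1 ij.2 (e ij.2 ℓ)‖ := by
  classical
  obtain ⟨n, hn, hnk⟩ := exists_sum_eq_of_div_le m hm k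
  let B : ∀ i j : Fin m, H j →L[ℂ] H i := fun i j =>
    (PiLp.proj 2 H i).comp (T.comp
      ((PiLp.continuousLinearEquiv 2 ℂ H).symm.toContinuousLinearMap.comp
        (ContinuousLinearMap.single ℂ H j)))
  have hB : ∀ i j x, Tblock i j x = B i j x := fun i j x => hTblock i j x
  set M : ℝ := ⨆ ij : Fin m × Fin m,
    ∑' ℓ : {ℓ : ℕ // k / m ≤ ℓ}, ‖Tblock ij.1 ij.2 (e ij.2 ℓ)‖
  have hM0 : 0 ≤ M := Real.iSup_nonneg fun ij => tsum_nonneg fun ℓ => norm_nonneg _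
  have hcomp : ∀ (v : PiLp 2 H) (i : Fin m), T v i = ∑ j, Tblock i j (v j) := by
    intro v i
    have hv : v = ∑ j, (PiLp.continuousLinearEquiv 2 ℂ H).symm (Pi.single j (v j)) := by
      rw [← map_sum, Finset.univ_sum_single (fun j => v j)]
      rfl
    have h : PiLp.proj (𝕜 := ℂ) 2 H i (T v) = ∑ j, PiLp.proj (𝕜 := ℂ) 2 H i
        (T ((PiLp.continuousLinearEquiv 2 ℂ H).symm (Pi.single j (v j)))) := by
      conv_lhs => rw [hv]
      rw [map_sum, map_sum]
    exact h.trans (Finset.sum_congr rfl fun j _ => (hTblock i j (v j)).symm)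
  refine le_trans (csInf_le ⟨0, ?_⟩ ⟨(leadingCoefficients e n).ker, ?_, ?_, rfl⟩) ?_
  · rintro s ⟨V, -, -, rfl⟩
    refine Real.sSup_nonneg ?_
    rintro t ⟨v, -, -, rfl⟩
    exact norm_nonneg _
  · exact (leadingCoefficients e n).isClosed_ker
  · let φ := (leadingCoefficients e n).toLinearMap.quotKerEquivOfSurjective
      (leadingCoefficients_surjective e n)
    refine ⟨φ.symm.finiteDimensional, φ.finrank_eq.trans ?_⟩
    simp [hnk]
  · refine Real.sSup_le ?_ (by positivity)
    rintro t ⟨v, hv, hv1, rfl⟩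
    have hblock : ∀ ij : Fin m × Fin m, ‖Tblock ij.1 ij.2 (v ij.2)‖ ≤
        if ∃ x, Tblock ij.1 ij.2 x ≠ 0 then M else 0 := by
      rintro ⟨i, j⟩
      split_ifs with h
      · refine le_trans ?_ (le_ciSup (Set.finite_range _).bddAbove (i, j))
        simp only [hB] at hsum ⊢
        refine (e j).norm_map_le_tsum_tail (B i j) (hsum i j) _ _
          ((PiLp.norm_apply_le v j).trans hv1.le) fun ℓ hℓ => ?_
        exact congrFun (LinearMap.mem_ker.1 hv) ⟨j, ℓ, hℓ.trans_le (hn j)⟩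
      · push Not at h
        simp [h]
    calc ‖T v‖ ≤ ∑ i, ‖T v i‖ := PiLp.norm_le_sum_norm _
      _ ≤ ∑ i, ∑ j, ‖Tblock i j (v j)‖ := by
        refine Finset.sum_le_sum fun i _ => ?_
        rw [hcomp]
        exact norm_sum_le _ _
      _ = ∑ ij : Fin m × Fin m, ‖Tblock ij.1 ij.2 (v ij.2)‖ :=
        (Fintype.sum_prod_type' fun i j => ‖Tblock i j (v j)‖).symm
      _ ≤ ∑ ij : Fin m × Fin m, if ∃ x, Tblock ij.1 ij.2 x ≠ 0 then M else 0 :=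
        Finset.sum_le_sum fun ij _ => hblock ij
      _ = _ := by
        rw [← Finset.sum_filter, Finset.sum_const, nsmul_eq_mul, Set.ncard_eq_toFinset_card',
          Set.toFinset_ofPred]
end
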